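/- Let ρ_X be the standard normal density on ℝ^n, f : ℝ^n → ℝ continuously differentiable with ρ_X-square-integrable gradient, C = ∫ ∇f ∇fᵀ ρ_X dx = W Λ Wᵀ with eigenvalues λ₁ ≥ ⋯ ≥ λ_n ≥ 0 and eigenvector matrix W. Let Ŵ = [Ŵ₁ Ŵ₂] be an orthogonal matrix with Ŵ₁ ∈ ℝ^{n×k} and ‖W − Ŵ‖ ≤ ε in spectral norm. Define ĝ(ŷ) = ∫_{ℝ^{n−k}} f(Ŵ₁ŷ + Ŵ₂ẑ) φ_{n−k}(ẑ) dẑ and f_ĝ(x) = ĝ(Ŵ₁ᵀx). Then ∫_{ℝ^n} (f(x) − f_ĝ(x))² ρ_X(x) dx ≤ ( ε(λ₁ + ⋯ + λ_k)^{1/2} + (λ_{k+1} + ⋯ + λ_n)^{1/2} )². -/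

import Mathlib

open MeasureTheory Matrix Set
open scoped Matrix.Norms.L2Operator

/-- The standard normal density on `ℝ^n`. -/
noncomputable def gaussDensity (n : ℕ) (x : Fin n → ℝ) : ℝ :=
  (2 * Real.pi) ^ (-(n : ℝ) / 2) * Real.exp (-(∑ i, x i ^ 2) / 2)

/-- The vector of partial derivatives (gradient) of `f : ℝ^n → ℝ`. -/
noncomputable def pgrad {n : ℕ} (f : (Fin n → ℝ) → ℝ) (x : Fin n → ℝ) : Fin n → ℝ :=
  fun i => fderiv ℝ f x (Pi.single i 1)

open ProbabilityTheory

/-- Cauchy-Schwarz for interval integrals of continuous functions. -/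
lemma sq_intervalIntegral_le {g : ℝ → ℝ} (hg : Continuous g) {a b : ℝ} (hab : a ≤ b) :
    (∫ t in a..b, g t) ^ 2 ≤ (b - a) * ∫ t in a..b, (g t) ^ 2 := by
  rcases hab.eq_or_lt with rfl | hlt
  · simp
  set I := ∫ t in a..b, g t with hI
  set J := ∫ t in a..b, (g t) ^ 2 with hJ
  have h0 : 0 ≤ ∫ t in a..b, ((b - a) * g t - I) ^ 2 :=
    intervalIntegral.integral_nonneg hab (fun t _ => sq_nonneg _)
  have h1 : ∫ t in a..b, ((b - a) * g t - I) ^ 2 =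
      (b - a) ^ 2 * J - 2 * (b - a) * I * I + (b - a) * I ^ 2 := by
    have : ∀ t, ((b - a) * g t - I) ^ 2 =
        (b - a) ^ 2 * (g t) ^ 2 - 2 * (b - a) * I * g t + I ^ 2 := fun t => by ring
    simp_rw [this]
    rw [intervalIntegral.integral_add, intervalIntegral.integral_sub,
      intervalIntegral.integral_const_mul, intervalIntegral.integral_const_mul]
    · simp [hI, hJ]
    all_goals exact Continuous.intervalIntegrable (by fun_prop) _ _
  rw [h1] at h0
  have h2 : 0 ≤ (b - a) * ((b - a) * J - I ^ 2) := by nlinarith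
  have h3 := nonneg_of_mul_nonneg_right h2 (by linarith)
  linarith

lemma hasDerivAt_gpdf (x : ℝ) :
    HasDerivAt (gaussianPDFReal 0 1) (-(x * gaussianPDFReal 0 1 x)) x := by
  have h : gaussianPDFReal 0 1 =
      fun x => (Real.sqrt (2 * Real.pi))⁻¹ * Real.exp (-(x ^ 2) / 2) := by
    ext x; simp [gaussianPDFReal]
  rw [h]
  have h1 : HasDerivAt (fun x : ℝ => -(x ^ 2) / 2) (-x) x := by
    have h2 := ((hasDerivAt_pow 2 x).fun_neg).div_const 2
    exact h2.congr_deriv (by norm_num; ring)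
  exact (h1.exp.const_mul ((Real.sqrt (2 * Real.pi))⁻¹)).congr_deriv (by ring)

lemma tendsto_gpdf_atTop : Filter.Tendsto (gaussianPDFReal 0 1) Filter.atTop (nhds 0) := by
  have h : gaussianPDFReal 0 1 =
      fun x => (Real.sqrt (2 * Real.pi))⁻¹ * Real.exp (-(x ^ 2) / 2) := by
    ext x; simp [gaussianPDFReal]
  rw [h]
  rw [show (0:ℝ) = (Real.sqrt (2 * Real.pi))⁻¹ * 0 by simp]
  refine Filter.Tendsto.const_mul _ (Real.tendsto_exp_atBot.comp ?_)
  have : Filter.Tendsto (fun x : ℝ => x ^ 2 / 2) Filter.atTop Filter.atTop :=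
    (Filter.tendsto_pow_atTop (two_ne_zero)).atTop_div_const (by norm_num)
  refine (Filter.tendsto_neg_atTop_atBot.comp this).congr (fun x => ?_)
  simp; ring

lemma gpdf_neg (x : ℝ) : gaussianPDFReal 0 1 (-x) = gaussianPDFReal 0 1 x := by
  simp [gaussianPDFReal]

lemma tendsto_gpdf_atBot : Filter.Tendsto (gaussianPDFReal 0 1) Filter.atBot (nhds 0) := by
  refine (tendsto_gpdf_atTop.comp Filter.tendsto_neg_atBot_atTop).congr (fun x => ?_)
  simp [gpdf_neg]

lemma integrable_id_gauss : Integrable (fun x : ℝ => x) (gaussianReal 0 1) :=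
  (memLp_id_gaussianReal 1).integrable (by simp)

lemma integrable_mul_gpdf : Integrable (fun x : ℝ => x * gaussianPDFReal 0 1 x) := by
  have h := integrable_id_gauss
  rw [gaussianReal_of_var_ne_zero _ one_ne_zero,
    integrable_withDensity_iff (measurable_gaussianPDF 0 1)
      (Filter.Eventually.of_forall fun x => gaussianPDF_lt_top)] at h
  simpa using h

lemma setIntegral_gauss {s : Set ℝ} (hs : MeasurableSet s) (g : ℝ → ℝ) :
    ∫ x in s, g x ∂(gaussianReal 0 1) = ∫ x in s, g x * gaussianPDFReal 0 1 x := by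
  rw [← integral_indicator hs, integral_gaussianReal_eq_integral_smul one_ne_zero,
    ← integral_indicator hs]
  congr 1; ext x
  by_cases hx : x ∈ s <;> simp [hx, mul_comm]

lemma setIntegral_Ici_id (s : ℝ) :
    ∫ x in Ici s, x ∂(gaussianReal 0 1) = gaussianPDFReal 0 1 s := by
  rw [setIntegral_gauss measurableSet_Ici, integral_Ici_eq_integral_Ioi]
  have := integral_Ioi_of_hasDerivAt_of_tendsto' (a := s) (f := fun x => - gaussianPDFReal 0 1 x)
    (f' := fun x => x * gaussianPDFReal 0 1 x) (m := 0)
    (fun x _ => (hasDerivAt_gpdf x).fun_neg.congr_deriv (by ring)) integrable_mul_gpdf.integrableOn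
    (by simpa using tendsto_gpdf_atTop.neg)
  rw [this]; simp

lemma setIntegral_Iio_id (s : ℝ) :
    ∫ x in Iio s, x ∂(gaussianReal 0 1) = - gaussianPDFReal 0 1 s := by
  rw [setIntegral_gauss measurableSet_Iio, ← integral_Iic_eq_integral_Iio]
  have := integral_Iic_of_hasDerivAt_of_tendsto' (a := s) (f := fun x => - gaussianPDFReal 0 1 x)
    (f' := fun x => x * gaussianPDFReal 0 1 x) (m := 0)
    (fun x _ => (hasDerivAt_gpdf x).fun_neg.congr_deriv (by ring)) integrable_mul_gpdf.integrableOn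
    (by simpa using tendsto_gpdf_atBot.neg)
  rw [this]; simp

/-- The kernel identity `∫∫_{y < s ≤ x} (x - y) dγ dγ = φ(s)`. -/
lemma kernel_eq (s : ℝ) :
    ∫⁻ x in Ici s, ∫⁻ y in Iio s, ENNReal.ofReal (x - y) ∂(gaussianReal 0 1) ∂(gaussianReal 0 1)
      = ENNReal.ofReal (gaussianPDFReal 0 1 s) := by
  set γ := gaussianReal 0 1
  have hi : Integrable (fun x : ℝ => x) γ := integrable_id_gauss
  set p := γ.real (Iio s) with hp
  have hq : γ.real (Ici s) = 1 - p := by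
    have := measureReal_compl (μ := γ) (measurableSet_Iio (a := s))
    rw [compl_Iio] at this
    simpa using this
  have h1 : ∀ x ∈ Ici s, ∫⁻ y in Iio s, ENNReal.ofReal (x - y) ∂γ =
      ENNReal.ofReal (p * x + gaussianPDFReal 0 1 s) := by
    intro x hx
    rw [← ofReal_integral_eq_lintegral_ofReal]
    · congr 1
      rw [integral_sub (integrable_const _) hi.integrableOn, setIntegral_Iio_id]
      simp [hp]
    · exact (integrable_const _).sub hi.integrableOn
    · refine (ae_restrict_iff' measurableSet_Iio).2 (Filter.Eventually.of_forall fun y hy => ?_)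
      simp only [mem_Ici, mem_Iio, Pi.zero_apply] at *
      linarith
  rw [setLIntegral_congr_fun measurableSet_Ici h1, ← ofReal_integral_eq_lintegral_ofReal]
  · congr 1
    rw [integral_add ((hi.const_mul p).integrableOn) (integrable_const _), integral_const_mul,
      setIntegral_Ici_id]
    simp only [integral_const, measureReal_restrict_apply_univ, smul_eq_mul, hq]
    ring
  · exact ((hi.const_mul p).integrableOn).add (integrable_const _)
  · refine (ae_restrict_iff' measurableSet_Ici).2 (Filter.Eventually.of_forall fun x hx => ?_)
    have h2 : 0 ≤ ∫ y in Iio s, (x - y) ∂γ := by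
      refine setIntegral_nonneg measurableSet_Iio fun y hy => ?_
      simp only [mem_Ici, mem_Iio] at *
      linarith
    rw [integral_sub (integrable_const _) hi.integrableOn, setIntegral_Iio_id] at h2
    simpa [hp] using h2

/-- Two-point form of the energy `∫∫ (f x - f y)^2`. -/
noncomputable def dbl {α : Type*} [MeasurableSpace α] (μ : Measure α) (f : α → ℝ) : ENNReal :=
  ∫⁻ x, ∫⁻ y, ENNReal.ofReal ((f x - f y) ^ 2) ∂μ ∂μ

/-- Pointwise bound by the fundamental theorem of calculus and Cauchy-Schwarz. -/
lemma ofReal_sq_sub_le {f : ℝ → ℝ} (hf : ContDiff ℝ 1 f) (x y : ℝ) (h : y ≤ x) :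
    ENNReal.ofReal ((f x - f y) ^ 2) ≤
      ∫⁻ s in Ioc y x, ENNReal.ofReal (x - y) * ENNReal.ofReal ((deriv f s) ^ 2) := by
  have hc : Continuous (deriv f) := hf.continuous_deriv le_rfl
  have h1 : ∫ t in y..x, deriv f t = f x - f y :=
    intervalIntegral.integral_deriv_eq_sub
      (fun t _ => (hf.differentiable one_ne_zero).differentiableAt) (hc.intervalIntegrable _ _)
  rw [lintegral_const_mul _ (by fun_prop), ← h1]
  calc _ ≤ ENNReal.ofReal ((x - y) * ∫ t in y..x, (deriv f t) ^ 2) :=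
        ENNReal.ofReal_le_ofReal (sq_intervalIntegral_le hc h)
    _ = _ := by
        rw [ENNReal.ofReal_mul (by linarith), intervalIntegral.integral_of_le h,
          ofReal_integral_eq_lintegral_ofReal]
        · have : IntervalIntegrable (fun t => deriv f t ^ 2) volume y x :=
            Continuous.intervalIntegrable (by fun_prop) _ _
          exact (intervalIntegrable_iff_integrableOn_Ioc_of_le h).1 this
        · exact Filter.Eventually.of_forall fun t => sq_nonneg _

/-- One-dimensional Gaussian Poincaré inequality, two-point form. -/
lemma dbl_gauss_le {f : ℝ → ℝ} (hf : ContDiff ℝ 1 f) :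
    dbl (gaussianReal 0 1) f ≤
      2 * ∫⁻ s, ENNReal.ofReal ((deriv f s) ^ 2) ∂(gaussianReal 0 1) := by
  set γ := gaussianReal 0 1 with hγ
  have hc : Continuous (deriv f) := hf.continuous_deriv le_rfl
  -- the kernel
  let K : ℝ → ℝ → ℝ → ENNReal := fun s x y =>
    (Ici s).indicator (fun x => (Iio s).indicator (fun y => ENNReal.ofReal (x - y)) y) x
  have hKm : Measurable (fun p : ℝ × ℝ × ℝ => K p.1 p.2.1 p.2.2) := by
    have : (fun p : ℝ × ℝ × ℝ => K p.1 p.2.1 p.2.2) =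
        ({p : ℝ × ℝ × ℝ | p.1 ≤ p.2.1} ∩ {p : ℝ × ℝ × ℝ | p.2.2 < p.1}).indicator
          (fun p => ENNReal.ofReal (p.2.1 - p.2.2)) := by
      ext p
      by_cases h1 : p.1 ≤ p.2.1 <;> by_cases h2 : p.2.2 < p.1 <;> simp [K, indicator, h1, h2]
    rw [this]
    refine Measurable.indicator (by fun_prop) ?_
    exact (measurableSet_le (by fun_prop) (by fun_prop)).inter
      (measurableSet_lt (by fun_prop) (by fun_prop))
  have hKint : ∀ s, ∫⁻ x, ∫⁻ y, K s x y ∂γ ∂γ = ENNReal.ofReal (gaussianPDFReal 0 1 s) := by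
    intro s
    rw [← kernel_eq, ← lintegral_indicator measurableSet_Ici]
    congr 1; ext x
    by_cases hx : x ∈ Ici s
    · simp only [K, indicator_of_mem hx]
      rw [lintegral_indicator measurableSet_Iio]
    · simp only [K, indicator_of_notMem hx]
      simp
  have hKint2 : ∀ s, ∫⁻ x, ∫⁻ y, K s y x ∂γ ∂γ = ENNReal.ofReal (gaussianPDFReal 0 1 s) := by
    intro s
    rw [← hKint s, lintegral_lintegral_swap]
    refine Measurable.aemeasurable ?_
    exact hKm.comp (by fun_prop : Measurable fun p : ℝ × ℝ => (s, p.2, p.1))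
  have hpt : ∀ x y, ENNReal.ofReal ((f x - f y) ^ 2) ≤
      ∫⁻ s, (K s x y + K s y x) * ENNReal.ofReal ((deriv f s) ^ 2) := by
    intro x y
    rcases le_total y x with h | h
    · refine (ofReal_sq_sub_le hf x y h).trans ?_
      rw [← lintegral_indicator measurableSet_Ioc]
      refine lintegral_mono fun s => ?_
      by_cases hs : s ∈ Ioc y x
      · rw [indicator_of_mem hs]
        gcongr
        refine le_trans (le_of_eq ?_) le_self_add
        simp [K, indicator, hs.1, hs.2]
      · rw [indicator_of_notMem hs]; exact zero_le
    · rw [show (f x - f y) ^ 2 = (f y - f x) ^ 2 by ring]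
      refine (ofReal_sq_sub_le hf y x h).trans ?_
      rw [← lintegral_indicator measurableSet_Ioc]
      refine lintegral_mono fun s => ?_
      by_cases hs : s ∈ Ioc x y
      · rw [indicator_of_mem hs]
        gcongr
        refine le_trans (le_of_eq ?_) le_add_self
        simp [K, indicator, hs.1, hs.2]
      · rw [indicator_of_notMem hs]; exact zero_le
  have hdm : Measurable (fun s => ENNReal.ofReal ((deriv f s) ^ 2)) := by fun_prop
  have hm1 : ∀ s, Measurable (fun p : ℝ × ℝ => K s p.1 p.2) := fun s =>
    hKm.comp (by fun_prop : Measurable fun p : ℝ × ℝ => (s, p.1, p.2))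
  have hm2 : ∀ s, Measurable (fun p : ℝ × ℝ => K s p.2 p.1) := fun s =>
    hKm.comp (by fun_prop : Measurable fun p : ℝ × ℝ => (s, p.2, p.1))
  have hmF : Measurable (fun p : (ℝ × ℝ) × ℝ =>
      (K p.2 p.1.1 p.1.2 + K p.2 p.1.2 p.1.1) * ENNReal.ofReal ((deriv f p.2) ^ 2)) := by
    refine Measurable.mul (Measurable.add ?_ ?_) (by fun_prop)
    · exact hKm.comp (by fun_prop : Measurable fun p : (ℝ × ℝ) × ℝ => (p.2, p.1.1, p.1.2))
    · exact hKm.comp (by fun_prop : Measurable fun p : (ℝ × ℝ) × ℝ => (p.2, p.1.2, p.1.1))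
  calc dbl γ f ≤ ∫⁻ x, ∫⁻ y, ∫⁻ s, (K s x y + K s y x) * ENNReal.ofReal ((deriv f s) ^ 2)
        ∂volume ∂γ ∂γ := lintegral_mono fun x => lintegral_mono fun y => hpt x y
    _ = ∫⁻ p, ∫⁻ s, (K s p.1 p.2 + K s p.2 p.1) * ENNReal.ofReal ((deriv f s) ^ 2)
        ∂volume ∂(γ.prod γ) := by
        rw [lintegral_prod _ (hmF.lintegral_prod_right').aemeasurable]
    _ = ∫⁻ s, ∫⁻ p, (K s p.1 p.2 + K s p.2 p.1) * ENNReal.ofReal ((deriv f s) ^ 2)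
        ∂(γ.prod γ) := by
        rw [lintegral_lintegral_swap hmF.aemeasurable]
    _ = ∫⁻ s, 2 * (gaussianPDF 0 1 s * ENNReal.ofReal ((deriv f s) ^ 2)) := by
        congr 1; ext s
        rw [lintegral_mul_const _ ((hm1 s).fun_add (hm2 s)), lintegral_add_left (hm1 s),
          lintegral_prod _ (hm1 s).aemeasurable, lintegral_prod _ (hm2 s).aemeasurable,
          hKint, hKint2, gaussianPDF, ← two_mul, mul_assoc]
    _ = 2 * ∫⁻ s, ENNReal.ofReal ((deriv f s) ^ 2) ∂γ := by
        rw [lintegral_const_mul _ ((measurable_gaussianPDF 0 1).fun_mul hdm), hγ,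
          gaussianReal_of_var_ne_zero _ one_ne_zero,
          lintegral_withDensity_eq_lintegral_mul _ (measurable_gaussianPDF 0 1) hdm]
        rfl

section Tensor

variable {α β : Type*} [MeasurableSpace α] [MeasurableSpace β]

lemma dbl_comp {μ : Measure α} {ν : Measure β} [SFinite μ] [SFinite ν] {T : α → β}
    (hT : MeasurePreserving T μ ν)
    {f : β → ℝ} (hf : Measurable f) : dbl ν f = dbl μ (fun x => f (T x)) := by
  unfold dbl
  rw [← hT.lintegral_comp (f := fun x => ∫⁻ y, ENNReal.ofReal ((f x - f y) ^ 2) ∂ν)]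
  · congr 1; ext x
    rw [← hT.lintegral_comp (f := fun y => ENNReal.ofReal ((f (T x) - f y) ^ 2))]
    fun_prop
  · exact Measurable.lintegral_prod_right'
      (f := fun p : β × β => ENNReal.ofReal ((f p.1 - f p.2) ^ 2)) (by fun_prop)

/-- Rearrangement of a fourfold integral. -/
lemma lintegral_four {μ : Measure α} {ν : Measure β} [SFinite μ] [SFinite ν]
    {F : (α × β) × (α × β) → ENNReal} (hF : Measurable F) :
    ∫⁻ p, ∫⁻ q, F (p, q) ∂(μ.prod ν) ∂(μ.prod ν) =
      ∫⁻ r, F ((r.1.1, r.2.1), (r.1.2, r.2.2)) ∂((μ.prod μ).prod (ν.prod ν)) := by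
  have hG : Measurable (fun r : (α × α) × (β × β) => F ((r.1.1, r.2.1), (r.1.2, r.2.2))) := by
    fun_prop
  rw [lintegral_prod _ hG.aemeasurable,
    lintegral_prod _ hG.lintegral_prod_right'.aemeasurable,
    lintegral_prod _ hF.lintegral_prod_right'.aemeasurable]
  congr 1; ext x
  have h1 : ∀ z : β, ∫⁻ q, F ((x, z), q) ∂(μ.prod ν) =
      ∫⁻ x', ∫⁻ z', F ((x, z), (x', z')) ∂ν ∂μ := fun z => by
    rw [lintegral_prod]
    exact Measurable.aemeasurable (by fun_prop)
  have h2 : ∀ x' : α, ∫⁻ w : β × β, F ((x, w.1), (x', w.2)) ∂(ν.prod ν) =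
      ∫⁻ z, ∫⁻ z', F ((x, z), (x', z')) ∂ν ∂ν := fun x' => by
    rw [lintegral_prod]
    exact Measurable.aemeasurable (by fun_prop)
  simp only [h1, h2]
  rw [lintegral_lintegral_swap]
  refine Measurable.aemeasurable ?_
  exact Measurable.lintegral_prod_right'
    (f := fun p : (β × α) × β => F ((x, p.1.1), (p.1.2, p.2))) (by fun_prop)

lemma quad_ineq (a b c d : ℝ) :
    ENNReal.ofReal ((a - d) ^ 2) + ENNReal.ofReal ((b - c) ^ 2) ≤
      ENNReal.ofReal ((a - b) ^ 2) + ENNReal.ofReal ((c - d) ^ 2) +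
      (ENNReal.ofReal ((a - c) ^ 2) + ENNReal.ofReal ((b - d) ^ 2)) := by
  rw [← ENNReal.ofReal_add, ← ENNReal.ofReal_add, ← ENNReal.ofReal_add, ← ENNReal.ofReal_add]
  · refine ENNReal.ofReal_le_ofReal ?_
    nlinarith [sq_nonneg (a - b - c + d)]
  all_goals positivity

/-- Tensorization of the two-point energy. -/
lemma dbl_prod_le {μ : Measure α} {ν : Measure β} [IsProbabilityMeasure μ]
    [IsProbabilityMeasure ν] {f : α × β → ℝ} (hf : Measurable f) :
    dbl (μ.prod ν) f ≤
      ∫⁻ z, dbl μ (fun x => f (x, z)) ∂ν + ∫⁻ x, dbl ν (fun z => f (x, z)) ∂μ := by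
  set P := (μ.prod μ).prod (ν.prod ν)
  have hL : dbl (μ.prod ν) f =
      ∫⁻ r, ENNReal.ofReal ((f (r.1.1, r.2.1) - f (r.1.2, r.2.2)) ^ 2) ∂P :=
    lintegral_four (F := fun p => ENNReal.ofReal ((f p.1 - f p.2) ^ 2)) (by fun_prop)
  have hswap : MeasurePreserving
      (Prod.map Prod.swap id : (α × α) × (β × β) → (α × α) × (β × β)) P P :=
    Measure.measurePreserving_swap.prod (MeasurePreserving.id _)
  have hL2 : dbl (μ.prod ν) f =
      ∫⁻ r, ENNReal.ofReal ((f (r.1.2, r.2.1) - f (r.1.1, r.2.2)) ^ 2) ∂P := by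
    rw [hL, ← hswap.lintegral_comp (by fun_prop)]
    rfl
  have hA : ∫⁻ q : (α × α) × β, ENNReal.ofReal ((f (q.1.1, q.2) - f (q.1.2, q.2)) ^ 2)
      ∂((μ.prod μ).prod ν) = ∫⁻ z, dbl μ (fun x => f (x, z)) ∂ν := by
    rw [lintegral_prod_symm _ (Measurable.aemeasurable (by fun_prop))]
    congr 1; ext z
    rw [lintegral_prod _ (Measurable.aemeasurable (by fun_prop))]
    rfl
  have hB : ∫⁻ q : α × (β × β), ENNReal.ofReal ((f (q.1, q.2.1) - f (q.1, q.2.2)) ^ 2)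
      ∂(μ.prod (ν.prod ν)) = ∫⁻ x, dbl ν (fun z => f (x, z)) ∂μ := by
    rw [lintegral_prod _ (Measurable.aemeasurable (by fun_prop))]
    congr 1; ext z
    rw [lintegral_prod _ (Measurable.aemeasurable (by fun_prop))]
    rfl
  have pA1 : MeasurePreserving (Prod.map id Prod.fst : (α × α) × (β × β) → (α × α) × β)
      P ((μ.prod μ).prod ν) := (MeasurePreserving.id _).prod measurePreserving_fst
  have pA2 : MeasurePreserving (Prod.map id Prod.snd : (α × α) × (β × β) → (α × α) × β)
      P ((μ.prod μ).prod ν) := (MeasurePreserving.id _).prod measurePreserving_snd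
  have pB1 : MeasurePreserving (Prod.map Prod.fst id : (α × α) × (β × β) → α × (β × β))
      P (μ.prod (ν.prod ν)) := measurePreserving_fst.prod (MeasurePreserving.id _)
  have pB2 : MeasurePreserving (Prod.map Prod.snd id : (α × α) × (β × β) → α × (β × β))
      P (μ.prod (ν.prod ν)) := measurePreserving_snd.prod (MeasurePreserving.id _)
  have hA1 := pA1.lintegral_comp
    (f := fun q => ENNReal.ofReal ((f (q.1.1, q.2) - f (q.1.2, q.2)) ^ 2)) (by fun_prop)
  have hA2 := pA2.lintegral_comp
    (f := fun q => ENNReal.ofReal ((f (q.1.1, q.2) - f (q.1.2, q.2)) ^ 2)) (by fun_prop)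
  have hB1 := pB1.lintegral_comp
    (f := fun q => ENNReal.ofReal ((f (q.1, q.2.1) - f (q.1, q.2.2)) ^ 2)) (by fun_prop)
  have hB2 := pB2.lintegral_comp
    (f := fun q => ENNReal.ofReal ((f (q.1, q.2.1) - f (q.1, q.2.2)) ^ 2)) (by fun_prop)
  rw [hA] at hA1 hA2
  rw [hB] at hB1 hB2
  have key : ∫⁻ r, (ENNReal.ofReal ((f (r.1.1, r.2.1) - f (r.1.2, r.2.2)) ^ 2) +
        ENNReal.ofReal ((f (r.1.2, r.2.1) - f (r.1.1, r.2.2)) ^ 2)) ∂P ≤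
      ∫⁻ r, ((ENNReal.ofReal ((f (r.1.1, r.2.1) - f (r.1.2, r.2.1)) ^ 2) +
        ENNReal.ofReal ((f (r.1.1, r.2.2) - f (r.1.2, r.2.2)) ^ 2)) +
        (ENNReal.ofReal ((f (r.1.1, r.2.1) - f (r.1.1, r.2.2)) ^ 2) +
        ENNReal.ofReal ((f (r.1.2, r.2.1) - f (r.1.2, r.2.2)) ^ 2))) ∂P :=
    lintegral_mono fun r => quad_ineq _ _ _ _
  rw [lintegral_add_left (by fun_prop), lintegral_add_left (by fun_prop),
    lintegral_add_left (by fun_prop), lintegral_add_left (by fun_prop), ← hL, ← hL2] at key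
  simp only [Prod.map_fst, Prod.map_snd, id] at hA1 hA2 hB1 hB2
  rw [hA1, hA2, hB1, hB2, ← two_mul, ← two_mul, ← two_mul, ← mul_add] at key
  exact (ENNReal.mul_le_mul_iff_right (by simp) (by simp)).1 key

/-- The variance is at most half of the two-point energy. -/
lemma two_mul_var_le_dbl {μ : Measure α} [IsProbabilityMeasure μ] {h : α → ℝ}
    (hh : Measurable h) :
    2 * ∫⁻ x, ENNReal.ofReal ((h x - ∫ y, h y ∂μ) ^ 2) ∂μ ≤ dbl μ h := by
  by_cases hfin : dbl μ h = ⊤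
  · rw [hfin]; exact le_top
  have hae : ∀ᵐ x ∂μ, ∫⁻ y, ENNReal.ofReal ((h x - h y) ^ 2) ∂μ < ⊤ :=
    ae_lt_top (Measurable.lintegral_prod_right'
      (f := fun p : α × α => ENNReal.ofReal ((h p.1 - h p.2) ^ 2)) (by fun_prop)) hfin
  obtain ⟨x₀, hx₀⟩ := hae.exists
  have hmem0 : MemLp (fun y => h x₀ - h y) 2 μ := by
    rw [memLp_two_iff_integrable_sq (Measurable.aestronglyMeasurable (by fun_prop))]
    refine ⟨Measurable.aestronglyMeasurable (by fun_prop), ?_⟩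
    rw [hasFiniteIntegral_iff_ofReal (Filter.Eventually.of_forall fun y => sq_nonneg _)]
    exact hx₀
  have hmem : MemLp h 2 μ := by
    have := (memLp_const (h x₀)).sub hmem0
    refine this.congr_norm hh.aestronglyMeasurable (Filter.Eventually.of_forall fun y => ?_)
    simp
  have hint : Integrable h μ := hmem.integrable (by norm_num)
  set m := ∫ y, h y ∂μ with hm
  have hmc : MemLp (fun y => h y - m) 2 μ := hmem.sub (memLp_const m)
  have hsq : Integrable (fun y => (h y - m) ^ 2) μ := hmc.integrable_sq
  set V := ∫ y, (h y - m) ^ 2 ∂μ with hV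
  have hV0 : 0 ≤ V := integral_nonneg fun y => sq_nonneg _
  have hVl : ∫⁻ x, ENNReal.ofReal ((h x - m) ^ 2) ∂μ = ENNReal.ofReal V :=
    (ofReal_integral_eq_lintegral_ofReal hsq
      (Filter.Eventually.of_forall fun y => sq_nonneg _)).symm
  have hin : ∀ x, ∫⁻ y, ENNReal.ofReal ((h x - h y) ^ 2) ∂μ =
      ENNReal.ofReal ((h x - m) ^ 2) + ENNReal.ofReal V := by
    intro x
    have heq : ∀ y, (h x - h y) ^ 2 =
        ((h x - m) ^ 2 - (2 * (h x - m)) * (h y - m)) + (h y - m) ^ 2 := fun y => by ring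
    have hi1 : Integrable (fun y => (2 * (h x - m)) * (h y - m)) μ :=
      (hint.sub (integrable_const m)).const_mul _
    have hi2 : Integrable (fun y => (h x - m) ^ 2 - (2 * (h x - m)) * (h y - m)) μ :=
      (integrable_const _).sub hi1
    rw [← ofReal_integral_eq_lintegral_ofReal, ← ENNReal.ofReal_add (sq_nonneg _) hV0]
    · congr 1
      simp_rw [heq]
      rw [integral_add hi2 hsq, integral_sub (integrable_const _) hi1, integral_const_mul,
        integral_sub hint (integrable_const m)]
      simp [← hm, ← hV]
    · simp_rw [heq]
      exact hi2.add hsq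
    · exact Filter.Eventually.of_forall fun y => sq_nonneg _
  unfold dbl
  simp_rw [hin]
  rw [lintegral_add_left (by fun_prop), hVl, two_mul]
  simp

end Tensor

/-- The standard Gaussian measure on `ℝ^n`. -/
noncomputable def gam (n : ℕ) : Measure (Fin n → ℝ) := Measure.pi fun _ => gaussianReal 0 1

instance (n : ℕ) : IsProbabilityMeasure (gam n) := by unfold gam; infer_instance

lemma fderiv_line {E F : Type*} [NormedAddCommGroup E] [NormedSpace ℝ E]
    [NormedAddCommGroup F] [NormedSpace ℝ F] {f : F → ℝ} {A : E → F} {z v : E} {w : F}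
    (hf : DifferentiableAt ℝ f (A z)) (hfA : DifferentiableAt ℝ (fun z => f (A z)) z)
    (hA : ∀ t : ℝ, A (z + t • v) = A z + t • w) :
    fderiv ℝ (fun z => f (A z)) z v = fderiv ℝ f (A z) w := by
  rw [← hf.lineDeriv_eq_fderiv, ← hfA.lineDeriv_eq_fderiv]
  unfold lineDeriv
  simp_rw [hA]

lemma continuous_pgrad {n : ℕ} {f : (Fin n → ℝ) → ℝ} (hf : ContDiff ℝ 1 f) (i : Fin n) :
    Continuous (fun x => pgrad f x i) := by
  unfold pgrad
  exact (hf.continuous_fderiv one_ne_zero).clm_apply continuous_const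

/-- Gaussian Poincaré inequality in `ℝ^n`, two-point form. -/
lemma dbl_gam_le (n : ℕ) : ∀ {f : (Fin n → ℝ) → ℝ}, ContDiff ℝ 1 f →
    dbl (gam n) f ≤ 2 * ∑ i, ∫⁻ x, ENNReal.ofReal ((pgrad f x i) ^ 2) ∂(gam n) := by
  induction n with
  | zero =>
    intro f hf
    have : dbl (gam 0) f = 0 := by
      unfold dbl
      have : ∀ x y : Fin 0 → ℝ, f x - f y = 0 := fun x y => by rw [Subsingleton.elim x y]; simp
      simp [this]
    rw [this]; exact zero_le
  | succ n ih =>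
    intro f hf
    have hmp : MeasurePreserving (fun p : ℝ × (Fin n → ℝ) => (Fin.cons p.1 p.2 : Fin (n+1) → ℝ))
        ((gaussianReal 0 1).prod (gam n)) (gam (n + 1)) := by
      have := (measurePreserving_piFinSuccAbove (fun _ : Fin (n+1) => gaussianReal 0 1) 0).symm
      convert this using 1
      · ext p i
        refine Fin.cases ?_ (fun j => ?_) i <;> simp [MeasurableEquiv.piFinSuccAbove]
      · rfl
      · rfl
    have hcons : ContDiff ℝ 1
        (fun p : ℝ × (Fin n → ℝ) => (Fin.cons p.1 p.2 : Fin (n+1) → ℝ)) := by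
      rw [contDiff_pi]
      intro i
      refine Fin.cases ?_ (fun j => ?_) i
      · simp only [Fin.cons_zero]; fun_prop
      · simp only [Fin.cons_succ]; fun_prop
    have hg : ContDiff ℝ 1 (fun p : ℝ × (Fin n → ℝ) => f (Fin.cons p.1 p.2)) := hf.comp hcons
    have hdf := hf.differentiable one_ne_zero
    have hg1 : ∀ z, ContDiff ℝ 1 (fun x : ℝ => f (Fin.cons x z)) := fun z =>
      hg.comp (contDiff_id.prodMk contDiff_const)
    have hg2 : ∀ x, ContDiff ℝ 1 (fun z : Fin n → ℝ => f (Fin.cons x z)) := fun x =>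
      hg.comp (contDiff_const.prodMk contDiff_id)
    have hd1 : ∀ x z, deriv (fun x : ℝ => f (Fin.cons x z)) x = pgrad f (Fin.cons x z) 0 := by
      intro x z
      rw [← fderiv_apply_one_eq_deriv]
      refine fderiv_line (A := fun x : ℝ => (Fin.cons x z : Fin (n+1) → ℝ)) (hdf _)
        ((hg1 z).differentiable one_ne_zero _) fun t => ?_
      ext i
      refine Fin.cases ?_ (fun j => ?_) i <;> simp
    have hd2 : ∀ x z i, pgrad (fun z : Fin n → ℝ => f (Fin.cons x z)) z i =
        pgrad f (Fin.cons x z) i.succ := by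
      intro x z i
      refine fderiv_line (A := fun z : Fin n → ℝ => (Fin.cons x z : Fin (n+1) → ℝ)) (hdf _)
        ((hg2 x).differentiable one_ne_zero _) fun t => ?_
      ext l
      refine Fin.cases ?_ (fun j => ?_) l
      · simp
      · simp [Pi.single_apply]
    have hpm : ∀ i, Measurable (fun p : ℝ × (Fin n → ℝ) =>
        ENNReal.ofReal ((pgrad f (Fin.cons p.1 p.2) i) ^ 2)) := fun i => by
      have := ((continuous_pgrad hf i).comp hcons.continuous).measurable
      simp only [Function.comp_def] at this
      fun_prop
    have hI : ∀ i, ∫⁻ x, ENNReal.ofReal ((pgrad f x i) ^ 2) ∂(gam (n + 1)) =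
        ∫⁻ p, ENNReal.ofReal ((pgrad f (Fin.cons p.1 p.2) i) ^ 2)
          ∂((gaussianReal 0 1).prod (gam n)) := fun i => by
      have := (continuous_pgrad hf i).measurable
      exact (hmp.lintegral_comp (f := fun x => ENNReal.ofReal ((pgrad f x i) ^ 2))
        (by fun_prop)).symm
    rw [dbl_comp hmp hf.continuous.measurable]
    refine (dbl_prod_le hg.continuous.measurable).trans ?_
    rw [Fin.sum_univ_succ, mul_add]
    refine add_le_add ?_ ?_
    · rw [hI, lintegral_prod_symm _ (hpm 0).aemeasurable,
        ← lintegral_const_mul _ (hpm 0).lintegral_prod_left']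
      refine lintegral_mono fun z => (dbl_gauss_le (hg1 z)).trans (le_of_eq ?_)
      simp_rw [hd1]
    · have h3 : ∀ x, dbl (gam n) (fun z => f (Fin.cons x z)) ≤
          2 * ∑ i : Fin n, ∫⁻ z, ENNReal.ofReal ((pgrad f (Fin.cons x z) i.succ) ^ 2) ∂(gam n) :=
        fun x => by
          have := ih (hg2 x)
          simp_rw [hd2] at this
          exact this
      refine (lintegral_mono h3).trans (le_of_eq ?_)
      rw [lintegral_const_mul, lintegral_finsetSum]
      · congr 1
        refine Finset.sum_congr rfl fun i _ => ?_
        rw [hI, lintegral_prod _ (hpm _).aemeasurable]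
      · exact fun i _ => (hpm i.succ).lintegral_prod_right'
      · exact Finset.measurable_fun_sum _ fun i _ => (hpm i.succ).lintegral_prod_right'

lemma gaussDensity_eq_prod (n : ℕ) (x : Fin n → ℝ) :
    gaussDensity n x = ∏ i, gaussianPDFReal 0 1 (x i) := by
  have h2 : (0:ℝ) ≤ 2 * Real.pi := by positivity
  simp only [gaussDensity, gaussianPDFReal, Finset.prod_mul_distrib, ← Real.exp_sum]
  congr 1
  · simp only [NNReal.coe_one, mul_one, Finset.prod_const, Finset.card_univ, Fintype.card_fin]
    rw [Real.sqrt_eq_rpow, ← Real.rpow_neg h2, ← Real.rpow_natCast, ← Real.rpow_mul h2]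
    congr 1; ring
  · congr 1
    simp [Finset.sum_div, neg_div]

lemma gaussDensity_nonneg (n : ℕ) (x : Fin n → ℝ) : 0 ≤ gaussDensity n x := by
  unfold gaussDensity; positivity

lemma measurable_gaussDensity (n : ℕ) : Measurable (gaussDensity n) := by
  unfold gaussDensity; fun_prop

lemma gam_eq (n : ℕ) :
    gam n = volume.withDensity (fun x => ENNReal.ofReal (gaussDensity n x)) := by
  refine Measure.pi_eq fun s hs => ?_
  have hint : ∀ i, Integrable (gaussianPDFReal 0 1) ((volume : Measure ℝ).restrict (s i)) :=
    fun i => (integrable_gaussianPDFReal 0 1).integrableOn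
  rw [withDensity_apply _ (MeasurableSet.univ_pi hs), volume_pi, Measure.restrict_pi_pi]
  simp_rw [gaussDensity_eq_prod]
  rw [← ofReal_integral_eq_lintegral_ofReal]
  · rw [integral_fintype_prod_eq_prod (f := fun _ => gaussianPDFReal 0 1),
      ENNReal.ofReal_prod_of_nonneg]
    · refine Finset.prod_congr rfl fun i _ => ?_
      rw [gaussianReal_apply_eq_integral _ one_ne_zero]
    · exact fun i _ => integral_nonneg fun x => gaussianPDFReal_nonneg _ _ _
  · exact Integrable.fintype_prod (f := fun _ => gaussianPDFReal 0 1) hint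
  · exact Filter.Eventually.of_forall fun x =>
      Finset.prod_nonneg fun i _ => gaussianPDFReal_nonneg _ _ _

lemma integral_gam (n : ℕ) (g : (Fin n → ℝ) → ℝ) :
    ∫ x, g x * gaussDensity n x = ∫ x, g x ∂(gam n) := by
  rw [gam_eq, integral_withDensity_eq_integral_toReal_smul
    (measurable_gaussDensity n).ennreal_ofReal
    (Filter.Eventually.of_forall fun x => ENNReal.ofReal_lt_top)]
  congr 1; ext x
  rw [ENNReal.toReal_ofReal (gaussDensity_nonneg n x), smul_eq_mul, mul_comm]

lemma integrable_gam (n : ℕ) (g : (Fin n → ℝ) → ℝ) :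
    Integrable (fun x => g x * gaussDensity n x) ↔ Integrable g (gam n) := by
  rw [gam_eq, integrable_withDensity_iff (measurable_gaussDensity n).ennreal_ofReal
    (Filter.Eventually.of_forall fun x => ENNReal.ofReal_lt_top)]
  simp_rw [ENNReal.toReal_ofReal (gaussDensity_nonneg n _)]

lemma sum_sq_mulVec {n : ℕ} {M : Matrix (Fin n) (Fin n) ℝ} (hM : Mᵀ * M = 1) (x : Fin n → ℝ) :
    ∑ i, (M *ᵥ x) i ^ 2 = ∑ i, x i ^ 2 := by
  have h : ∀ y : Fin n → ℝ, ∑ i, y i ^ 2 = y ⬝ᵥ y := fun y => by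
    simp [dotProduct, sq]
  rw [h, h, dotProduct_mulVec, ← mulVec_transpose, mulVec_mulVec, hM, one_mulVec]

/-- Rotation invariance of the standard Gaussian. -/
lemma gam_rot {n : ℕ} {M : Matrix (Fin n) (Fin n) ℝ} (hM : Mᵀ * M = 1) :
    MeasurePreserving (fun x => M *ᵥ x) (gam n) (gam n) := by
  have hdet : M.det * M.det = 1 := by
    have := congrArg Matrix.det hM
    simpa using this
  have hd0 : M.det ≠ 0 := fun h => by simp [h] at hdet
  have habs : |M.det⁻¹| = 1 := by
    rcases mul_self_eq_one_iff.1 hdet with h | h <;> simp [h]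
  have hvol : MeasurePreserving (fun x => M *ᵥ x) (volume : Measure (Fin n → ℝ)) volume := by
    refine ⟨by fun_prop, ?_⟩
    have := Real.map_matrix_volume_pi_eq_smul_volume_pi hd0
    rw [habs, ENNReal.ofReal_one, one_smul] at this
    exact this
  have hdm := (measurable_gaussDensity n).ennreal_ofReal
  refine ⟨hvol.measurable, ?_⟩
  ext s hs
  rw [Measure.map_apply hvol.measurable hs, gam_eq, withDensity_apply _ hs,
    withDensity_apply _ (hvol.measurable hs), ← hvol.setLIntegral_comp_preimage hs hdm]
  simp only [gaussDensity, sum_sq_mulVec hM]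

lemma gam_append (k m : ℕ) :
    MeasurePreserving (fun p : (Fin k → ℝ) × (Fin m → ℝ) => Fin.append p.1 p.2)
      ((gam k).prod (gam m)) (gam (k + m)) := by
  have hm : Measurable (fun p : (Fin k → ℝ) × (Fin m → ℝ) => Fin.append p.1 p.2) := by
    refine measurable_pi_iff.2 fun i => ?_
    refine Fin.addCases (fun j => ?_) (fun j => ?_) i
    · simp only [Fin.append_left]; fun_prop
    · simp only [Fin.append_right]; fun_prop
  refine ⟨hm, (Measure.pi_eq fun s hs => ?_).symm⟩
  have hpre : (fun p : (Fin k → ℝ) × (Fin m → ℝ) => Fin.append p.1 p.2) ⁻¹' (Set.pi univ s) =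
      (Set.pi univ fun i => s (Fin.castAdd m i)) ×ˢ (Set.pi univ fun j => s (Fin.natAdd k j)) := by
    ext p
    simp only [mem_preimage, Set.mem_pi, mem_univ, forall_const, mem_prod]
    constructor
    · intro h
      exact ⟨fun i => by simpa using h (Fin.castAdd m i), fun j => by simpa using h (Fin.natAdd k j)⟩
    · rintro ⟨h1, h2⟩ i
      refine Fin.addCases (fun j => ?_) (fun j => ?_) i
      · simpa using h1 j
      · simpa using h2 j
  rw [Measure.map_apply hm (MeasurableSet.univ_pi hs), hpre, Measure.prod_prod, gam, gam,
    Measure.pi_pi, Measure.pi_pi, Fin.prod_univ_add]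

lemma mulVec_append {k m : ℕ} (M : Matrix (Fin (k + m)) (Fin (k + m)) ℝ)
    (y : Fin k → ℝ) (z : Fin m → ℝ) :
    M *ᵥ (Fin.append y z) =
      M.submatrix id (Fin.castAdd m) *ᵥ y + M.submatrix id (Fin.natAdd k) *ᵥ z := by
  ext i
  simp [mulVec, dotProduct, Fin.sum_univ_add]

lemma transpose_mulVec_append {k m : ℕ} {M : Matrix (Fin (k + m)) (Fin (k + m)) ℝ}
    (hM : Mᵀ * M = 1) (y : Fin k → ℝ) (z : Fin m → ℝ) :
    (M.submatrix id (Fin.castAdd m))ᵀ *ᵥ (M *ᵥ Fin.append y z) = y := by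
  have h : Mᵀ *ᵥ (M *ᵥ Fin.append y z) = Fin.append y z := by
    rw [mulVec_mulVec, hM, one_mulVec]
  ext i
  have := congrFun h (Fin.castAdd m i)
  simpa [mulVec, dotProduct] using this

lemma fderiv_eq_sum {n : ℕ} (f : (Fin n → ℝ) → ℝ) (x w : Fin n → ℝ) :
    fderiv ℝ f x w = ∑ a, w a * pgrad f x a := by
  conv_lhs => rw [pi_eq_sum_univ' w]
  simp [pgrad, map_sum]

/-- Reduction to the gradient in the inactive directions. -/
lemma lintegral_bound {k m : ℕ} {f : (Fin (k + m) → ℝ) → ℝ} (hf : ContDiff ℝ 1 f)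
    {M : Matrix (Fin (k + m)) (Fin (k + m)) ℝ} (hM : Mᵀ * M = 1) {g : (Fin k → ℝ) → ℝ}
    (hg : ∀ y, g y = ∫ z, f (M.submatrix id (Fin.castAdd m) *ᵥ y +
      M.submatrix id (Fin.natAdd k) *ᵥ z) ∂(gam m)) :
    ∫⁻ x, ENNReal.ofReal ((f x - g ((M.submatrix id (Fin.castAdd m))ᵀ *ᵥ x)) ^ 2) ∂(gam (k + m)) ≤
      ∑ j : Fin m, ∫⁻ x, ENNReal.ofReal ((∑ a, M a (Fin.natAdd k j) * pgrad f x a) ^ 2)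
        ∂(gam (k + m)) := by
  simp_rw [← mulVec_append] at hg
  have hT : MeasurePreserving (fun p : (Fin k → ℝ) × (Fin m → ℝ) => M *ᵥ Fin.append p.1 p.2)
      ((gam k).prod (gam m)) (gam (k + m)) := (gam_rot hM).comp (gam_append k m)
  have hTc : ContDiff ℝ 1 (fun p : (Fin k → ℝ) × (Fin m → ℝ) => M *ᵥ Fin.append p.1 p.2) := by
    simp_rw [mulVec_append]
    rw [contDiff_pi]
    intro i
    simp only [Pi.add_apply, mulVec, dotProduct]
    fun_prop
  have hfT : ContDiff ℝ 1
      (fun p : (Fin k → ℝ) × (Fin m → ℝ) => f (M *ᵥ Fin.append p.1 p.2)) := hf.comp hTc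
  have hfTm := hfT.continuous.measurable
  have hgm : Measurable g := by
    have : g = fun y => ∫ z, f (M *ᵥ Fin.append y z) ∂(gam m) := funext hg
    rw [this]
    exact (hfTm.stronglyMeasurable.integral_prod_right').measurable
  have hfm := hf.continuous.measurable
  have hsl : ∀ y, ContDiff ℝ 1 (fun z : Fin m → ℝ => f (M *ᵥ Fin.append y z)) := fun y =>
    hfT.comp (contDiff_const.prodMk contDiff_id)
  have hgr : ∀ y z j, pgrad (fun z : Fin m → ℝ => f (M *ᵥ Fin.append y z)) z j =
      ∑ a, M a (Fin.natAdd k j) * pgrad f (M *ᵥ Fin.append y z) a := by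
    intro y z j
    rw [← fderiv_eq_sum f _ (fun a => M a (Fin.natAdd k j))]
    refine fderiv_line (A := fun z : Fin m → ℝ => M *ᵥ Fin.append y z)
      (hf.differentiable one_ne_zero _) ((hsl y).differentiable one_ne_zero _) fun t => ?_
    simp only [mulVec_append, mulVec_add, mulVec_smul, ← add_assoc]
    congr 2
    ext a
    simp
  have hpm : ∀ j : Fin m, Measurable (fun x : Fin (k + m) → ℝ =>
      ENNReal.ofReal ((∑ a, M a (Fin.natAdd k j) * pgrad f x a) ^ 2)) := fun j => by
    have : ∀ a, Measurable (fun x => pgrad f x a) := fun a => (continuous_pgrad hf a).measurable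
    fun_prop
  have hI : ∀ j : Fin m, ∫⁻ x, ENNReal.ofReal ((∑ a, M a (Fin.natAdd k j) * pgrad f x a) ^ 2)
        ∂(gam (k + m)) = ∫⁻ y, ∫⁻ z, ENNReal.ofReal
          ((∑ a, M a (Fin.natAdd k j) * pgrad f (M *ᵥ Fin.append y z) a) ^ 2)
          ∂(gam m) ∂(gam k) := fun j => by
    rw [← hT.lintegral_comp (hpm j), lintegral_prod]
    exact ((hpm j).comp hT.measurable).aemeasurable
  have hmeas : Measurable (fun x => ENNReal.ofReal
      ((f x - g ((M.submatrix id (Fin.castAdd m))ᵀ *ᵥ x)) ^ 2)) := by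
    have : Measurable (fun x => g ((M.submatrix id (Fin.castAdd m))ᵀ *ᵥ x)) :=
      hgm.comp (by fun_prop)
    fun_prop
  rw [← hT.lintegral_comp hmeas, lintegral_prod]
  swap
  · exact (hmeas.comp hT.measurable).aemeasurable
  simp_rw [transpose_mulVec_append hM, hI]
  rw [← lintegral_finsetSum]
  · refine lintegral_mono fun y => ?_
    have h1 := two_mul_var_le_dbl (μ := gam m) (hsl y).continuous.measurable
    have h2 := h1.trans (dbl_gam_le m (hsl y))
    rw [← hg y] at h2
    simp_rw [hgr] at h2
    exact (ENNReal.mul_le_mul_iff_right (by simp) (by simp)).1 h2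
  · exact fun j _ => ((hpm j).comp hT.measurable).lintegral_prod_right'

/-- Row bound for a transposed matrix in spectral norm. -/
lemma sum_sq_transpose_mulVec_le {n : ℕ} (A : Matrix (Fin n) (Fin n) ℝ) {ε : ℝ} (hA : ‖A‖ ≤ ε)
    (w : Fin n → ℝ) (hw : ∑ a, w a ^ 2 = 1) :
    ∑ b, (Aᵀ *ᵥ w) b ^ 2 ≤ ε ^ 2 := by
  have h := l2_opNorm_mulVec Aᵀ (WithLp.toLp 2 w)
  have hn : ‖Aᵀ‖ = ‖A‖ := by
    rw [← l2_opNorm_conjTranspose A, conjTranspose_eq_transpose_of_trivial]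
  have hw1 : ‖(WithLp.toLp 2 w : EuclideanSpace ℝ (Fin n))‖ = 1 := by
    rw [EuclideanSpace.norm_eq]; simp [hw]
  rw [hn, hw1, mul_one] at h
  have h' := h.trans hA
  rw [EuclideanSpace.norm_eq] at h'
  have h3 := (Real.sqrt_le_iff.1 h').2
  simpa using h3

/-- The trace estimate. -/
lemma trace_bound {k m : ℕ} {W Wh : Matrix (Fin (k + m)) (Fin (k + m)) ℝ}
    (hW : Wᵀ * W = 1) (hWh : Whᵀ * Wh = 1) {Λ : Fin (k + m) → ℝ} (hΛ : ∀ i, 0 ≤ Λ i)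
    {ε : ℝ} (hpert : ‖W - Wh‖ ≤ ε) :
    ∑ j : Fin m, (Whᵀ * (W * diagonal Λ * Wᵀ) * Wh) (Fin.natAdd k j) (Fin.natAdd k j) ≤
      ε ^ 2 * (∑ j : Fin k, Λ (Fin.castAdd m j)) + ∑ j : Fin m, Λ (Fin.natAdd k j) := by
  have hcol : ∀ i, ∑ a, W a i ^ 2 = 1 := fun i => by
    have := congrFun (congrFun hW i) i
    simpa [Matrix.mul_apply, sq] using this
  have hWh' : Wh * Whᵀ = 1 := mul_eq_one_comm.1 hWh
  have hdiag : ∀ b, (Whᵀ * (W * diagonal Λ * Wᵀ) * Wh) b b = ∑ i, Λ i * ((Wᵀ * Wh) i b) ^ 2 := by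
    intro b
    have : Whᵀ * (W * diagonal Λ * Wᵀ) * Wh = (Wᵀ * Wh)ᵀ * diagonal Λ * (Wᵀ * Wh) := by
      simp [Matrix.transpose_mul, Matrix.mul_assoc]
    rw [this, Matrix.mul_apply]
    refine Finset.sum_congr rfl fun i _ => ?_
    rw [Matrix.mul_diagonal, transpose_apply]; ring
  simp_rw [hdiag]
  rw [Finset.sum_comm, Fin.sum_univ_add, Finset.mul_sum]
  refine add_le_add (Finset.sum_le_sum fun i _ => ?_) (Finset.sum_le_sum fun i _ => ?_)
  · rw [← Finset.mul_sum, mul_comm]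
    refine mul_le_mul_of_nonneg_right ?_ (hΛ _)
    have h := sum_sq_transpose_mulVec_le (W - Wh) hpert (fun a => W a (Fin.castAdd m i))
      (hcol (Fin.castAdd m i))
    rw [Fin.sum_univ_add] at h
    refine le_trans (le_of_eq ?_) (le_trans (le_add_of_nonneg_left
      (Finset.sum_nonneg fun _ _ => sq_nonneg _)) h)
    refine Finset.sum_congr rfl fun j _ => ?_
    have h0 : (Wᵀ * W) (Fin.castAdd m i) (Fin.natAdd k j) = 0 := by
      rw [hW, Matrix.one_apply_ne]
      intro h
      have := congrArg Fin.val h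
      simp at this
      omega
    have h1 : ((W - Wh)ᵀ *ᵥ fun a => W a (Fin.castAdd m i)) (Fin.natAdd k j) =
        (Wᵀ * W) (Fin.castAdd m i) (Fin.natAdd k j) -
          (Wᵀ * Wh) (Fin.castAdd m i) (Fin.natAdd k j) := by
      simp only [mulVec, dotProduct, Matrix.mul_apply, transpose_apply, Matrix.sub_apply,
        ← Finset.sum_sub_distrib]
      refine Finset.sum_congr rfl fun a _ => by ring
    rw [h1, h0]; ring
  · rw [← Finset.mul_sum]
    refine mul_le_of_le_one_right (hΛ _) ?_
    have h1 : ∑ b, ((Wᵀ * Wh) (Fin.natAdd k i) b) ^ 2 = 1 := by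
      have h2 : (Wᵀ * Wh) * (Wᵀ * Wh)ᵀ = 1 := by
        rw [Matrix.transpose_mul, transpose_transpose, Matrix.mul_assoc, ← Matrix.mul_assoc Wh,
          hWh', Matrix.one_mul, hW]
      have := congrFun (congrFun h2 (Fin.natAdd k i)) (Fin.natAdd k i)
      rw [Matrix.mul_apply] at this
      simpa [sq] using this
    rw [Fin.sum_univ_add] at h1
    have h3 : 0 ≤ ∑ b : Fin k, ((Wᵀ * Wh) (Fin.natAdd k i) (Fin.castAdd m b)) ^ 2 :=
      Finset.sum_nonneg fun _ _ => sq_nonneg _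
    linarith

/-- Perturbed ridge approximation bound in the Gaussian case: with
`C = ∫ ∇f ∇fᵀ ρX dx = W Λ Wᵀ`, a perturbed orthogonal matrix `Ŵ = [Ŵ₁ Ŵ₂]` (`Wh` below) with
`‖W - Ŵ‖ ≤ ε` in spectral norm, `ĝ(ŷ) = ∫ f(Ŵ₁ŷ + Ŵ₂ẑ) φ_m(ẑ) dẑ` and `f_ĝ(x) = ĝ(Ŵ₁ᵀx)`,
one has `∫ (f - f_ĝ)² ρX dx ≤ (ε(λ₁+⋯+λ_k)^{1/2} + (λ_{k+1}+⋯+λ_{k+m})^{1/2})²`. -/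
theorem mse_perturbed_conditional_expectation_bound
    (k m : ℕ)
    (f : (Fin (k + m) → ℝ) → ℝ)
    (hf : ContDiff ℝ 1 f)
    (hsq : ∀ i, Integrable fun x => (pgrad f x i) ^ 2 * gaussDensity (k + m) x)
    (W : Matrix (Fin (k + m)) (Fin (k + m)) ℝ)
    (hW : Wᵀ * W = 1)
    (Λ : Fin (k + m) → ℝ)
    (hΛdesc : ∀ i j, i ≤ j → Λ j ≤ Λ i)
    (hΛnonneg : ∀ i, 0 ≤ Λ i)
    (hC : (Matrix.of fun i j => ∫ x, pgrad f x i * pgrad f x j * gaussDensity (k + m) x) =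
      W * Matrix.diagonal Λ * Wᵀ)
    (Wh : Matrix (Fin (k + m)) (Fin (k + m)) ℝ)
    (hWh : Whᵀ * Wh = 1)
    (ε : ℝ) (hε : 0 < ε)
    (hpert : ‖W - Wh‖ ≤ ε)
    (gh : (Fin k → ℝ) → ℝ)
    (hgh : ∀ y, gh y = ∫ z, f (Wh.submatrix id (Fin.castAdd m) *ᵥ y +
      Wh.submatrix id (Fin.natAdd k) *ᵥ z) * gaussDensity m z) :
    ∫ x, (f x - gh ((Wh.submatrix id (Fin.castAdd m))ᵀ *ᵥ x)) ^ 2 * gaussDensity (k + m) x ≤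
      (ε * Real.sqrt (∑ j : Fin k, Λ (Fin.castAdd m j)) +
        Real.sqrt (∑ j : Fin m, Λ (Fin.natAdd k j))) ^ 2 := by
  have hfg : ∀ i, Continuous fun x => pgrad f x i := fun i => continuous_pgrad hf i
  have hsq' : ∀ i, MemLp (fun x => pgrad f x i) 2 (gam (k + m)) := fun i => by
    rw [memLp_two_iff_integrable_sq (hfg i).aestronglyMeasurable]
    exact (integrable_gam _ _).1 (hsq i)
  have hprod : ∀ i j, Integrable (fun x => pgrad f x i * pgrad f x j) (gam (k + m)) :=
    fun i j => (hsq' i).integrable_mul (hsq' j)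
  have hC' : ∀ i j, ∫ x, pgrad f x i * pgrad f x j ∂(gam (k + m)) =
      (W * Matrix.diagonal Λ * Wᵀ) i j := fun i j => by
    rw [← hC, Matrix.of_apply, integral_gam]
  simp_rw [integral_gam] at hgh
  rw [integral_gam]
  have hlin := lintegral_bound hf hWh hgh
  have hdir : ∀ b, ∫⁻ x, ENNReal.ofReal ((∑ a, Wh a b * pgrad f x a) ^ 2) ∂(gam (k + m)) =
      ENNReal.ofReal ((Whᵀ * (W * diagonal Λ * Wᵀ) * Wh) b b) := by
    intro b
    have hexp : ∀ x, (∑ a, Wh a b * pgrad f x a) ^ 2 =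
        ∑ c, ∑ a, (Wh a b * Wh c b) * (pgrad f x a * pgrad f x c) := fun x => by
      rw [sq, Finset.sum_mul_sum, Finset.sum_comm]
      refine Finset.sum_congr rfl fun c _ => Finset.sum_congr rfl fun a _ => by ring
    rw [← ofReal_integral_eq_lintegral_ofReal]
    · congr 1
      simp_rw [hexp]
      rw [integral_finsetSum _ fun c _ => integrable_finsetSum _ fun a _ =>
        (hprod a c).const_mul _, Matrix.mul_apply]
      refine Finset.sum_congr rfl fun c _ => ?_
      rw [integral_finsetSum _ fun a _ => (hprod a c).const_mul _, Matrix.mul_apply,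
        Finset.sum_mul]
      refine Finset.sum_congr rfl fun a _ => ?_
      rw [integral_const_mul, hC', transpose_apply]; ring
    · simp_rw [hexp]
      exact integrable_finsetSum _ fun c _ => integrable_finsetSum _ fun a _ =>
        (hprod a c).const_mul _
    · exact Filter.Eventually.of_forall fun x => sq_nonneg _
  have hnn : ∀ b, 0 ≤ (Whᵀ * (W * diagonal Λ * Wᵀ) * Wh) b b := by
    intro b
    have h1 : (Whᵀ * (W * diagonal Λ * Wᵀ) * Wh) b b = ∑ i, Λ i * ((Wᵀ * Wh) i b) ^ 2 := by
      have : Whᵀ * (W * diagonal Λ * Wᵀ) * Wh = (Wᵀ * Wh)ᵀ * diagonal Λ * (Wᵀ * Wh) := by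
        simp [Matrix.transpose_mul, Matrix.mul_assoc]
      rw [this, Matrix.mul_apply]
      refine Finset.sum_congr rfl fun i _ => ?_
      rw [Matrix.mul_diagonal, transpose_apply]; ring
    rw [h1]
    exact Finset.sum_nonneg fun i _ => mul_nonneg (hΛnonneg i) (sq_nonneg _)
  simp_rw [hdir] at hlin
  rw [← ENNReal.ofReal_sum_of_nonneg fun j _ => hnn _] at hlin
  have ha : 0 ≤ ∑ j : Fin k, Λ (Fin.castAdd m j) := Finset.sum_nonneg fun _ _ => hΛnonneg _
  have hb : 0 ≤ ∑ j : Fin m, Λ (Fin.natAdd k j) := Finset.sum_nonneg fun _ _ => hΛnonneg _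
  by_cases hint : Integrable (fun x =>
      (f x - gh ((Wh.submatrix id (Fin.castAdd m))ᵀ *ᵥ x)) ^ 2) (gam (k + m))
  · rw [← ofReal_integral_eq_lintegral_ofReal hint
      (Filter.Eventually.of_forall fun x => sq_nonneg _),
      ENNReal.ofReal_le_ofReal_iff (Finset.sum_nonneg fun j _ => hnn _)] at hlin
    refine (hlin.trans (trace_bound hW hWh hΛnonneg hpert)).trans ?_
    have h1 := Real.sq_sqrt ha
    have h2 := Real.sq_sqrt hb
    have h3 := mul_nonneg hε.le (mul_nonneg (Real.sqrt_nonneg (∑ j : Fin k, Λ (Fin.castAdd m j)))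
      (Real.sqrt_nonneg (∑ j : Fin m, Λ (Fin.natAdd k j))))
    rw [add_sq, mul_pow, h1, h2]
    linarith
  · rw [integral_undef hint]
    exact sq_nonneg _
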